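/- arXiv:1309.1443 — 5 statements merged into one kernel-verified Lean document; each statement's English description precedes it below -/
import Mathlib

section
/- Let T and X be self-adjoint operators on a nonzero finite-dimensional complex inner product space satisfying T² = X² = I and TX = −XT, and let γ > 0. For s ∈ [0,1] define H(s) = −γ((1−s)T + sX). Then H(s) has exactly two distinct eigenvalues, the difference between them (the spectral gap) equals 2γ√(1 − 2s + 2s²), and for all s ∈ [0,1] this gap is at least √2·γ, with equality if and only if s = 1/2. -/
theorem spectrum_eq_pair_of_sq_eq_of_anticommute {𝕜 A : Type*} [Field 𝕜] [Ring A] [Nontrivial A]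
    [Algebra 𝕜 A] {h n : A} {c : 𝕜} (hh : h * h = algebraMap 𝕜 A (c ^ 2)) (hn : IsUnit n)
    (hnh : n * h = -(h * n)) : spectrum 𝕜 h = {-c, c} := by
  ext r
  have hcomm : Commute (algebraMap 𝕜 A r) h := Algebra.commutes r h
  have hprod : (algebraMap 𝕜 A r - h) * (algebraMap 𝕜 A r + h) =
      algebraMap 𝕜 A (r ^ 2 - c ^ 2) := by
    rw [← hcomm.mul_self_sub_mul_self_eq', hh, ← map_mul, ← map_sub, pow_two r]
  have hconj : n * (algebraMap 𝕜 A r - h) = (algebraMap 𝕜 A r + h) * n := by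
    rw [mul_sub, add_mul, hnh, sub_neg_eq_add, Algebra.commutes]
  obtain ⟨u, rfl⟩ := hn
  have hiff : IsUnit (algebraMap 𝕜 A r - h) ↔ IsUnit (algebraMap 𝕜 A r + h) := by
    rw [← Units.isUnit_units_mul u, hconj, Units.isUnit_mul_units]
  have hcomm' : Commute (algebraMap 𝕜 A r - h) (algebraMap 𝕜 A r + h) :=
    ((Commute.refl _).add_right hcomm).sub_left (hcomm.symm.add_right (Commute.refl _))
  have hunit : IsUnit (algebraMap 𝕜 A r - h) ↔ IsUnit (algebraMap 𝕜 A (r ^ 2 - c ^ 2)) := by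
    rw [← hprod, hcomm'.isUnit_mul_iff, ← hiff, and_self]
  have hpair : r ∈ ({-c, c} : Set 𝕜) ↔ r ^ 2 - c ^ 2 = 0 := by
    rw [sub_eq_zero, sq_eq_sq_iff_eq_or_eq_neg, or_comm]
    rfl
  rw [spectrum.mem_iff, hunit, hpair]
  constructor
  · intro hr
    by_contra hne
    exact hr ((IsUnit.mk0 _ hne).map _)
  · intro hr
    simp [hr]

theorem smul_add_smul_mul_self_of_anticommute {𝕜 A : Type*} [CommRing 𝕜] [Ring A] [Algebra 𝕜 A]
    {t x : A} (ht : t * t = 1) (hx : x * x = 1) (htx : t * x = -(x * t)) (p q : 𝕜) :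
    (p • t + q • x) * (p • t + q • x) = algebraMap 𝕜 A (p ^ 2 + q ^ 2) := by
  simp only [add_mul, mul_add, smul_mul_smul_comm, ht, hx, htx, Algebra.algebraMap_eq_smul_one]
  module

theorem smul_add_smul_anticommute_of_anticommute {𝕜 A : Type*} [CommRing 𝕜] [Ring A] [Algebra 𝕜 A]
    {t x : A} (ht : t * t = 1) (hx : x * x = 1) (htx : t * x = -(x * t)) (p q : 𝕜) :
    (q • t + (-p) • x) * (p • t + q • x) = -((p • t + q • x) * (q • t + (-p) • x)) := by
  simp only [add_mul, mul_add, smul_mul_smul_comm, ht, hx, htx]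
  module


/-- for self-adjoint anticommuting involutions T, X and γ > 0, the
Hamiltonian H(s) = −γ((1−s)T + sX) has exactly two distinct eigenvalues, whose
difference (the spectral gap) equals 2γ√(1 − 2s + 2s²); this gap is ≥ √2·γ on
[0,1], with equality iff s = 1/2. -/
theorem stmt5 {E : Type*} [NormedAddCommGroup E] [InnerProductSpace ℂ E]
    [FiniteDimensional ℂ E] [Nontrivial E]
    (T X : E →L[ℂ] E) (hT : IsSelfAdjoint T) (hX : IsSelfAdjoint X)
    (hT2 : T ^ 2 = 1) (hX2 : X ^ 2 = 1) (hTX : T * X = -(X * T))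
    (γ : ℝ) (hγ : 0 < γ) :
    ∀ s ∈ Set.Icc (0 : ℝ) 1,
      (∃ a b : ℝ, a < b ∧
        spectrum ℂ (-((γ : ℂ) • ((1 - (s : ℂ)) • T + (s : ℂ) • X)))
            = {(a : ℂ), (b : ℂ)} ∧
        b - a = 2 * γ * Real.sqrt (1 - 2 * s + 2 * s ^ 2)) ∧
      Real.sqrt 2 * γ ≤ 2 * γ * Real.sqrt (1 - 2 * s + 2 * s ^ 2) ∧
      (2 * γ * Real.sqrt (1 - 2 * s + 2 * s ^ 2) = Real.sqrt 2 * γ ↔ s = 1 / 2) := by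
  intro s _
  have hpos : 0 < 1 - 2 * s + 2 * s ^ 2 := by nlinarith [sq_nonneg (2 * s - 1)]
  rw [pow_two] at hT2 hX2
  set r := Real.sqrt (1 - 2 * s + 2 * s ^ 2) with hr
  have hrpos : 0 < r := Real.sqrt_pos.2 hpos
  have hrsq : r ^ 2 = 1 - 2 * s + 2 * s ^ 2 := Real.sq_sqrt hpos.le
  have h2 : Real.sqrt 2 ^ 2 = 2 := Real.sq_sqrt zero_le_two
  have h2pos : 0 < Real.sqrt 2 := Real.sqrt_pos.2 zero_lt_two
  have hle : Real.sqrt 2 ≤ 2 * r :=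
    (sq_le_sq₀ h2pos.le (by positivity)).1 (by nlinarith [sq_nonneg (2 * s - 1)])
  refine ⟨⟨-(γ * r), γ * r, by nlinarith [mul_pos hγ hrpos], ?_, by ring⟩, by nlinarith, ?_, ?_⟩
  · have hH : -((γ : ℂ) • ((1 - (s : ℂ)) • T + (s : ℂ) • X)) =
        (-(γ * (1 - s)) : ℂ) • T + (-(γ * s) : ℂ) • X := by module
    have hc : (-(γ * (1 - s)) : ℂ) ^ 2 + (-(γ * s) : ℂ) ^ 2 = ((γ * r : ℝ) : ℂ) ^ 2 := by
      norm_cast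
      rw [mul_pow, hrsq]
      ring
    have hcne : ((γ * r : ℝ) : ℂ) ^ 2 ≠ 0 :=
      pow_ne_zero 2 (Complex.ofReal_ne_zero.2 (mul_pos hγ hrpos).ne')
    rw [hH, Complex.ofReal_neg]
    refine spectrum_eq_pair_of_sq_eq_of_anticommute ?_ ?_
      (smul_add_smul_anticommute_of_anticommute hT2 hX2 hTX _ _)
    · rw [smul_add_smul_mul_self_of_anticommute hT2 hX2 hTX, hc]
    · refine (isUnit_pow_iff two_ne_zero).1 ?_
      rw [pow_two, smul_add_smul_mul_self_of_anticommute hT2 hX2 hTX, neg_sq (-(γ * (1 - s)) : ℂ), add_comm, hc]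
      exact (IsUnit.mk0 _ hcne).map _
  · intro h
    have hreq : 2 * r = Real.sqrt 2 := mul_right_cancel₀ hγ.ne' (by linarith)
    have hsq : (2 * s - 1) ^ 2 = 0 := by
      have := congrArg (· ^ 2) hreq
      simp only [mul_pow, hrsq, h2] at this
      linarith
    linarith [pow_eq_zero_iff two_ne_zero |>.1 hsq]
  · intro h
    have hreq : 2 * r = Real.sqrt 2 :=
      (sq_eq_sq₀ (by positivity) h2pos.le).1 (by rw [mul_pow, hrsq, h2, h]; norm_num)
    rw [← hreq]
    ring
end

section
/- Let U be a nonempty finite index set and let {T_u}_{u∈U} and {X_u}_{u∈U} be self-adjoint operators on a nonzero finite-dimensional complex inner product space satisfying: T_u² = X_u² = I and T_u X_u = −X_u T_u for every u ∈ U, and for all u ≠ v in U each of T_u, X_u commutes with each of T_v, X_v. Let γ > 0 and s ∈ [0,1], and set η = √((1−s)² + s²). Then the spectrum of H(s) = −γ Σ_{u∈U} ((1−s)T_u + sX_u) is exactly {γ·η·m : m ∈ ℤ, |m| ≤ |U|, m ≡ |U| (mod 2)}; in particular the lowest eigenvalue is −γ|U|η, and the gap between the lowest and second-lowest eigenvalues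 equals 2γη ≥ √2·γ. -/
/-- Over a finite-dimensional space, the spectrum consists of the eigenvalues. -/
theorem ContinuousLinearMap.mem_spectrum_iff_exists_apply_eq_smul
    {𝕜 E : Type*} [NontriviallyNormedField 𝕜] [CompleteSpace 𝕜] [NormedAddCommGroup E]
    [NormedSpace 𝕜 E] [FiniteDimensional 𝕜 E] (H : E →L[𝕜] E) (μ : 𝕜) :
    μ ∈ spectrum 𝕜 H ↔ ∃ v : E, v ≠ 0 ∧ H v = μ • v := by
  rw [← AlgEquiv.spectrum_eq (Module.End.toContinuousLinearMap E).symm H,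
    ← Module.End.hasEigenvalue_iff_mem_spectrum]
  constructor
  · intro h
    obtain ⟨v, hv⟩ := h.exists_hasEigenvector
    exact ⟨v, hv.2, hv.apply_eq_smul⟩
  · rintro ⟨v, hv0, hv⟩
    exact Module.End.hasEigenvalue_of_hasEigenvector
      ⟨Module.End.mem_eigenspace_iff.2 hv, hv0⟩

section CommutingInvolutions

variable {𝕜 E ι : Type*} [NontriviallyNormedField 𝕜] [NormedAddCommGroup E] [NormedSpace 𝕜 E]

/-- An eigenvector of an operator `H` can be replaced by a simultaneous eigenvector of `H` and of
commuting operators `A u` that commute with `H` and square to the scalar `c ^ 2`. -/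
theorem exists_joint_eigenvector_of_sq_eq (A : ι → E →L[𝕜] E) (H : E →L[𝕜] E) (c : 𝕜)
    (hsq : ∀ u v, A u (A u v) = (c * c) • v) (hAA : ∀ u v, Commute (A u) (A v))
    (hAH : ∀ u, Commute (A u) H) (S : Finset ι) {μ : 𝕜} {v : E} (hv0 : v ≠ 0)
    (hv : H v = μ • v) :
    ∃ (w : E) (σ : ι → ℤˣ), w ≠ 0 ∧ H w = μ • w ∧
      ∀ u ∈ S, A u w = (((σ u : ℤ) : 𝕜) * c) • w := by
  classical
  induction S using Finset.induction_on with
  | empty => exact ⟨v, 1, hv0, hv, by simp⟩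
  | insert a S ha ih =>
    obtain ⟨w, σ, hw0, hw, hσ⟩ := ih
    by_cases h : A a w = c • w
    · refine ⟨w, Function.update σ a 1, hw0, hw, fun u hu => ?_⟩
      rcases eq_or_ne u a with rfl | hne
      · simpa using h
      · simpa [hne] using hσ u ((Finset.mem_insert.1 hu).resolve_left hne)
    · refine ⟨A a w - c • w, Function.update σ a (-1), sub_ne_zero.2 h, ?_, fun u hu => ?_⟩
      · have hc : H (A a w) = A a (H w) := congrArg (fun f : E →L[𝕜] E => f w) (hAH a).eq.symm
        rw [map_sub, map_smul, hc, hw, map_smul, smul_sub, smul_comm c μ]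
      · rcases eq_or_ne u a with rfl | hne
        · simp only [map_sub, map_smul, hsq, Function.update_self, Units.val_neg, Units.val_one,
            Int.cast_neg, Int.cast_one]
          module
        · have hc : A u (A a w) = A a (A u w) :=
            congrArg (fun f : E →L[𝕜] E => f w) (hAA u a).eq
          rw [map_sub, map_smul, hc, hσ u ((Finset.mem_insert.1 hu).resolve_left hne), map_smul,
            Function.update_of_ne hne]
          module

/-- If each `A u` anticommutes with an injective `B u` that commutes with the other `A v`, then
the signs of a joint eigenvector can be prescribed. -/
theorem exists_joint_eigenvector_of_signs [Fintype ι] (A B : ι → E →L[𝕜] E) (c : 𝕜)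
    (hB : ∀ u v, B u v = 0 → v = 0) (hanti : ∀ u, A u * B u = -(B u * A u))
    (hAB : ∀ u v, u ≠ v → Commute (A u) (B v)) {w : E} {τ : ι → ℤˣ} (hw0 : w ≠ 0)
    (hw : ∀ u, A u w = (((τ u : ℤ) : 𝕜) * c) • w) (σ : ι → ℤˣ) :
    ∃ v : E, v ≠ 0 ∧ ∀ u, A u v = (((σ u : ℤ) : 𝕜) * c) • v := by
  classical
  suffices h : ∀ S : Finset ι, ∃ (v : E) (ρ : ι → ℤˣ), v ≠ 0 ∧ (∀ u ∈ S, ρ u = σ u) ∧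
      ∀ u, A u v = (((ρ u : ℤ) : 𝕜) * c) • v by
    obtain ⟨v, ρ, hv0, hρ, hv⟩ := h Finset.univ
    exact ⟨v, hv0, fun u => hρ u (Finset.mem_univ u) ▸ hv u⟩
  intro S
  induction S using Finset.induction_on with
  | empty => exact ⟨w, τ, hw0, by simp, hw⟩
  | insert a S ha ih =>
    obtain ⟨v, ρ, hv0, hρ, hv⟩ := ih
    by_cases h : ρ a = σ a
    · exact ⟨v, ρ, hv0, (Finset.forall_mem_insert _ _ _).2 ⟨h, hρ⟩, hv⟩
    · refine ⟨B a v, Function.update ρ a (σ a), fun h0 => hv0 (hB a v h0), fun u hu => ?_,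
        fun u => ?_⟩
      · rcases eq_or_ne u a with rfl | hne
        · simp
        · simpa [hne] using hρ u ((Finset.mem_insert.1 hu).resolve_left hne)
      · rcases eq_or_ne u a with rfl | hne
        · have hc : A u (B u v) = -(B u (A u v)) :=
            congrArg (fun f : E →L[𝕜] E => f v) (hanti u)
          have hs : σ u = -ρ u := by
            rw [← Int.units_ne_iff_eq_neg]; exact Ne.symm h
          rw [hc, hv, map_smul, Function.update_self, hs]
          push_cast
          module
        · have hc : A u (B a v) = B a (A u v) :=
            congrArg (fun f : E →L[𝕜] E => f v) (hAB u a hne).eq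
          rw [hc, hv, map_smul, Function.update_of_ne hne]

end CommutingInvolutions

/-- The sums of `n` signs are the integers of absolute value at most `n` and the parity of `n`. -/
theorem exists_sum_units_eq_iff {ι : Type*} [Fintype ι] (m : ℤ) :
    (∃ σ : ι → ℤˣ, ∑ u, (σ u : ℤ) = m) ↔
      m.natAbs ≤ Fintype.card ι ∧ (m : ZMod 2) = (Fintype.card ι : ZMod 2) := by
  classical
  constructor
  · rintro ⟨σ, rfl⟩
    constructor
    · have h : |∑ u, (σ u : ℤ)| ≤ ∑ u, |(σ u : ℤ)| := Finset.abs_sum_le_sum_abs _ _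
      have h1 : ∀ u, |(σ u : ℤ)| = 1 := fun u => by
        rcases Int.units_eq_one_or (σ u) with h | h <;> simp [h]
      simp only [h1, Finset.sum_const, Finset.card_univ, nsmul_eq_mul, mul_one] at h
      rwa [Int.abs_eq_natAbs, Nat.cast_le] at h
    · have h1 : ∀ u, (((σ u : ℤ)) : ZMod 2) = 1 := fun u => by
        rcases Int.units_eq_one_or (σ u) with h | h <;> simp [h]
      simp [h1]
  · rintro ⟨hle, hpar⟩
    have hmod : m ≡ (Fintype.card ι : ℤ) [ZMOD 2] :=
      (ZMod.intCast_eq_intCast_iff _ _ 2).1 (by simpa using hpar)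
    obtain ⟨k, hk⟩ : ∃ k : ℕ, m = 2 * k - Fintype.card ι := by
      refine ⟨((m + Fintype.card ι) / 2).toNat, ?_⟩
      have := hmod.eq
      omega
    obtain ⟨S, -, hS⟩ := Finset.exists_subset_card_eq (s := (Finset.univ : Finset ι)) (n := k)
      (by rw [Finset.card_univ]; omega)
    refine ⟨fun u => if u ∈ S then 1 else -1, ?_⟩
    have h : ∀ u, (((if u ∈ S then 1 else -1 : ℤˣ)) : ℤ) = 2 * (if u ∈ S then 1 else 0) - 1 :=
      fun u => by split_ifs <;> simp
    simp only [h, Finset.sum_sub_distrib, ← Finset.mul_sum]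
    simp [hS, hk]

/-- The spectrum of a multiple of a sum of commuting square roots of `c ^ 2`, each of which
anticommutes with an injective operator commuting with the others. -/
theorem mem_spectrum_smul_sum_iff {𝕜 E ι : Type*} [NontriviallyNormedField 𝕜] [CompleteSpace 𝕜]
    [NormedAddCommGroup E] [NormedSpace 𝕜 E] [FiniteDimensional 𝕜 E] [Nontrivial E] [Fintype ι]
    (A B : ι → E →L[𝕜] E) (g c : 𝕜) (hsq : ∀ u v, A u (A u v) = (c * c) • v)
    (hAA : ∀ u v, Commute (A u) (A v)) (hB : ∀ u v, B u v = 0 → v = 0)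
    (hanti : ∀ u, A u * B u = -(B u * A u)) (hAB : ∀ u v, u ≠ v → Commute (A u) (B v)) (μ : 𝕜) :
    μ ∈ spectrum 𝕜 (g • ∑ u, A u) ↔ ∃ m : ℤ, m.natAbs ≤ Fintype.card ι ∧
      (m : ZMod 2) = (Fintype.card ι : ZMod 2) ∧ μ = g * c * m := by
  have key : ∀ {w : E} {σ : ι → ℤˣ}, (∀ u, A u w = (((σ u : ℤ) : 𝕜) * c) • w) →
      (g • ∑ u, A u) w = (g * c * ((∑ u, (σ u : ℤ) : ℤ) : 𝕜)) • w := by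
    intro w σ h
    simp only [smul_apply, sum_apply, h,
      ← Finset.sum_smul, ← Finset.sum_mul, smul_smul]
    push_cast
    ring_nf
  rw [ContinuousLinearMap.mem_spectrum_iff_exists_apply_eq_smul]
  simp only [← and_assoc, ← exists_sum_units_eq_iff]
  constructor
  · rintro ⟨v, hv0, hv⟩
    obtain ⟨w, σ, hw0, hw, hσ⟩ := exists_joint_eigenvector_of_sq_eq A (g • ∑ u, A u) c hsq hAA
      (fun u => (Commute.sum_right _ _ _ fun v _ => hAA u v).smul_right g) Finset.univ hv0 hv
    refine ⟨_, ⟨σ, rfl⟩, smul_left_injective 𝕜 hw0 ?_⟩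
    exact hw.symm.trans (key fun u => hσ u (Finset.mem_univ u))
  · rintro ⟨m, ⟨σ, rfl⟩, rfl⟩
    obtain ⟨v, hv0⟩ := exists_ne (0 : E)
    obtain ⟨w, τ, hw0, -, hτ⟩ := exists_joint_eigenvector_of_sq_eq A 1 c hsq hAA
      (fun u => Commute.one_right _) Finset.univ hv0 (one_smul 𝕜 v).symm
    obtain ⟨x, hx0, hx⟩ := exists_joint_eigenvector_of_signs A B c hB hanti hAB hw0
      (fun u => hτ u (Finset.mem_univ u)) σ
    exact ⟨x, hx0, key hx⟩

/-- A linear combination of two anticommuting involutions squares to a scalar. -/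
theorem smul_add_smul_mul_self_of_anticommute_s10 {R A : Type*} [CommRing R] [Ring A] [Algebra R A]
    {x y : A} (hx : x ^ 2 = 1) (hy : y ^ 2 = 1) (hxy : x * y = -(y * x)) (a b : R) :
    (a • x + b • y) * (a • x + b • y) = (a ^ 2 + b ^ 2) • (1 : A) := by
  rw [sq] at hx hy
  simp only [add_mul, mul_add, smul_mul_assoc, mul_smul_comm, hx, hy, hxy]
  module

/-- For anticommuting involutions, orthogonal linear combinations anticommute. -/
theorem smul_add_smul_anticommute {R A : Type*} [CommRing R] [Ring A] [Algebra R A]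
    {x y : A} (hx : x ^ 2 = 1) (hy : y ^ 2 = 1) (hxy : x * y = -(y * x)) (a b : R) :
    (a • x + b • y) * ((-b) • x + a • y) = -(((-b) • x + a • y) * (a • x + b • y)) := by
  rw [sq] at hx hy
  simp only [add_mul, mul_add, smul_mul_assoc, mul_smul_comm, hx, hy, hxy]
  module


/-- for a nonempty finite family of pairs (T_u, X_u) of self-adjoint
anticommuting involutions, with operators belonging to different indices commuting,
and γ > 0, s ∈ [0,1], the spectrum of H(s) = −γ Σ_u ((1−s)T_u + sX_u) is exactly
{γ·η·m : m ∈ ℤ, |m| ≤ |U|, m ≡ |U| (mod 2)} with η = √((1−s)²+s²); in particular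
the lowest eigenvalue is −γ|U|η, and the gap between the lowest and second-lowest
eigenvalues equals 2γη ≥ √2·γ. -/
theorem stmt10 {E : Type*} [NormedAddCommGroup E] [InnerProductSpace ℂ E]
    [FiniteDimensional ℂ E] [Nontrivial E]
    {ι : Type*} [Fintype ι] [Nonempty ι]
    (T X : ι → E →L[ℂ] E)
    (hsaT : ∀ u, IsSelfAdjoint (T u)) (hsaX : ∀ u, IsSelfAdjoint (X u))
    (hT2 : ∀ u, T u ^ 2 = 1) (hX2 : ∀ u, X u ^ 2 = 1)
    (hanti : ∀ u, T u * X u = -(X u * T u))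
    (hTT : ∀ u v, u ≠ v → Commute (T u) (T v))
    (hTX : ∀ u v, u ≠ v → Commute (T u) (X v))
    (hXX : ∀ u v, u ≠ v → Commute (X u) (X v))
    (γ : ℝ) (hγ : 0 < γ) (s : ℝ) (hs : s ∈ Set.Icc (0 : ℝ) 1) :
    spectrum ℂ (-((γ : ℂ) • ∑ u, ((1 - (s : ℂ)) • T u + (s : ℂ) • X u)))
        = {μ : ℂ | ∃ m : ℤ, m.natAbs ≤ Fintype.card ι ∧
            (m : ZMod 2) = (Fintype.card ι : ZMod 2) ∧
            μ = ((γ * Real.sqrt ((1 - s) ^ 2 + s ^ 2) * (m : ℝ) : ℝ) : ℂ)} ∧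
    IsLeast {lam : ℝ |
        (lam : ℂ) ∈ spectrum ℂ
          (-((γ : ℂ) • ∑ u, ((1 - (s : ℂ)) • T u + (s : ℂ) • X u)))}
      (-(γ * (Fintype.card ι : ℝ) * Real.sqrt ((1 - s) ^ 2 + s ^ 2))) ∧
    IsLeast {lam : ℝ |
        (lam : ℂ) ∈ spectrum ℂ
          (-((γ : ℂ) • ∑ u, ((1 - (s : ℂ)) • T u + (s : ℂ) • X u))) ∧
        lam ≠ -(γ * (Fintype.card ι : ℝ) * Real.sqrt ((1 - s) ^ 2 + s ^ 2))}
      (-(γ * ((Fintype.card ι : ℝ) - 2) * Real.sqrt ((1 - s) ^ 2 + s ^ 2))) ∧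
    (-(γ * ((Fintype.card ι : ℝ) - 2) * Real.sqrt ((1 - s) ^ 2 + s ^ 2)))
        - (-(γ * (Fintype.card ι : ℝ) * Real.sqrt ((1 - s) ^ 2 + s ^ 2)))
        = 2 * γ * Real.sqrt ((1 - s) ^ 2 + s ^ 2) ∧
    Real.sqrt 2 * γ ≤ 2 * γ * Real.sqrt ((1 - s) ^ 2 + s ^ 2) := by
  set η := Real.sqrt ((1 - s) ^ 2 + s ^ 2)
  have hpos : (1 : ℝ) / 2 ≤ (1 - s) ^ 2 + s ^ 2 := by nlinarith [sq_nonneg (2 * s - 1)]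
  have hη0 : 0 < η := Real.sqrt_pos.2 (by linarith)
  have hηsq : η * η = (1 - s) ^ 2 + s ^ 2 := Real.mul_self_sqrt (by linarith)
  have hηC : (η : ℂ) * η = (1 - (s : ℂ)) ^ 2 + (s : ℂ) ^ 2 := by exact_mod_cast hηsq
  have hcomm : ∀ (a b c d : ℂ) (u v : ι), u ≠ v →
      Commute (a • T u + b • X u) (c • T v + d • X v) := fun a b c d u v h =>
    (((hTT u v h).smul_left a).smul_right c |>.add_right
      (((hTX u v h).smul_left a).smul_right d)).add_left
    ((((hTX v u h.symm).symm.smul_left b).smul_right c).add_right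
      (((hXX u v h).smul_left b).smul_right d))
  have hmem : ∀ μ : ℂ, μ ∈ spectrum ℂ (-((γ : ℂ) • ∑ u, ((1 - (s : ℂ)) • T u + (s : ℂ) • X u))) ↔
      ∃ m : ℤ, m.natAbs ≤ Fintype.card ι ∧ (m : ZMod 2) = (Fintype.card ι : ZMod 2) ∧
        μ = ((γ * η * (m : ℝ) : ℝ) : ℂ) := by
    intro μ
    have h := mem_spectrum_smul_sum_iff (fun u => (1 - (s : ℂ)) • T u + (s : ℂ) • X u)
      (fun u => (-(s : ℂ)) • T u + (1 - (s : ℂ)) • X u) (-(γ : ℂ)) (-(η : ℂ))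
      (fun u v => ?_) (fun u v => ?_) (fun u v h0 => ?_)
      (fun u => smul_add_smul_anticommute (hT2 u) (hX2 u) (hanti u) _ _)
      (fun u v h => hcomm _ _ _ _ u v h) μ
    · rw [neg_smul] at h
      rw [h]
      push_cast
      simp only [neg_mul_neg]
    · rw [neg_mul_neg, hηC]
      exact congrArg (fun f : E →L[ℂ] E => f v)
        (smul_add_smul_mul_self_of_anticommute_s10 (hT2 u) (hX2 u) (hanti u) (1 - (s : ℂ)) (s : ℂ))
    · rcases eq_or_ne u v with rfl | h
      · exact Commute.refl _
      · exact hcomm _ _ _ _ u v h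
    · have h1 := congrArg (fun f : E →L[ℂ] E => f v)
        (smul_add_smul_mul_self_of_anticommute_s10 (hT2 u) (hX2 u) (hanti u) (-(s : ℂ)) (1 - (s : ℂ)))
      have h2 : (0 : E) = ((η : ℂ) * η) • v := by
        rw [hηC, add_comm, ← neg_sq (s : ℂ)]
        refine Eq.trans ?_ h1
        change (0 : E) = ((-(s : ℂ)) • T u + (1 - (s : ℂ)) • X u)
          (((-(s : ℂ)) • T u + (1 - (s : ℂ)) • X u) v)
        rw [h0, map_zero]
      have hne : (η : ℂ) ≠ 0 := by exact_mod_cast hη0.ne'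
      exact (smul_eq_zero.1 h2.symm).resolve_left (mul_ne_zero hne hne)
  have hγη : 0 < γ * η := mul_pos hγ hη0
  have hcard : 0 < Fintype.card ι := Fintype.card_pos
  simp only [hmem, Complex.ofReal_inj]
  refine ⟨Set.ext hmem, ⟨⟨-(Fintype.card ι : ℤ), by simp, by simp, ?_⟩, ?_⟩,
    ⟨⟨⟨2 - (Fintype.card ι : ℤ), by omega, ?_, ?_⟩, ?_⟩, ?_⟩, by ring, ?_⟩
  · push_cast
    ring
  · rintro _ ⟨m, hm, -, rfl⟩
    have h : (-(Fintype.card ι : ℤ) : ℝ) ≤ m := by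
      exact_mod_cast (by omega : -(Fintype.card ι : ℤ) ≤ m)
    push_cast at h
    nlinarith
  · have : (2 : ZMod 2) = 0 := rfl
    simp [this]
  · push_cast
    ring
  · intro h
    nlinarith
  · rintro _ ⟨⟨m, hm, hpar, rfl⟩, hne⟩
    have hmod : m ≡ (Fintype.card ι : ℤ) [ZMOD 2] :=
      (ZMod.intCast_eq_intCast_iff _ _ 2).1 (by simpa using hpar)
    have hm1 : m ≠ -(Fintype.card ι : ℤ) := by
      rintro rfl
      apply hne
      push_cast
      ring
    have hm2 : 2 - (Fintype.card ι : ℤ) ≤ m := by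
      have := hmod.eq
      omega
    have h : (2 - (Fintype.card ι : ℝ)) ≤ m := by exact_mod_cast hm2
    nlinarith
  · have h : Real.sqrt 2 ≤ 2 * η := Real.sqrt_le_iff.2 ⟨by linarith, by nlinarith⟩
    nlinarith
end

section
/- Let U be a nonempty finite index set and let {T_u}_{u∈U} and {X_u}_{u∈U} be self-adjoint operators on a nonzero finite-dimensional complex inner product space satisfying: T_u² = X_u² = I and T_u X_u = −X_u T_u for every u ∈ U, and for all u ≠ v in U each of T_u, X_u commutes with each of T_v, X_v. Then the operator norm of Σ_{u∈U} (T_u − X_u) equals √2·|U|. -/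
/-- Commuting families of pairs of operators `A u`, `B u`, with `A u` and `B u` anticommuting square
roots of `c ^ 2`, have a common eigenvector for the eigenvalue `c` of all the `A u`. -/
theorem exists_common_eigenvector_of_anticommuting {K V ι : Type*} [Field K] [AddCommGroup V]
    [Module K V] [Nontrivial V] {A B : ι → Module.End K V} {c : K} (hc : c ≠ 0)
    (hA : ∀ u x, A u (A u x) = c ^ 2 • x) (hB : ∀ u x, B u (B u x) = c ^ 2 • x)
    (hanti : ∀ u x, A u (B u x) = -B u (A u x))
    (hAA : ∀ u v, u ≠ v → ∀ x, A u (A v x) = A v (A u x))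
    (hAB : ∀ u v, u ≠ v → ∀ x, A u (B v x) = B v (A u x)) (s : Finset ι) :
    ∃ x : V, x ≠ 0 ∧ ∀ u ∈ s, A u x = c • x := by
  classical
  induction s using Finset.induction_on with
  | empty => simpa using exists_ne (0 : V)
  | insert w s hw ih =>
    obtain ⟨x, hx, h⟩ := ih
    have hne : ∀ u ∈ s, u ≠ w := fun u hu e => hw (e ▸ hu)
    by_cases h0 : A w x + c • x = 0
    · refine ⟨B w x, fun h1 => ?_, fun u hu => ?_⟩
      · have h2 := hB w x
        rw [h1, map_zero] at h2
        exact smul_ne_zero (pow_ne_zero 2 hc) hx h2.symm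
      · rcases Finset.mem_insert.1 hu with rfl | hu
        · rw [hanti, eq_neg_of_add_eq_zero_left h0, map_neg, map_smul, neg_neg]
        · rw [hAB u w (hne u hu), h u hu, map_smul]
    · refine ⟨_, h0, fun u hu => ?_⟩
      rcases Finset.mem_insert.1 hu with rfl | hu
      · rw [map_add, map_smul, hA, smul_add, smul_smul, ← sq, add_comm]
      · rw [map_add, map_smul, hAA u w (hne u hu), h u hu, map_smul, smul_add]

/-- for a nonempty finite family of pairs (T_u, X_u) of self-adjoint
anticommuting involutions, with operators belonging to different indices commuting,
the operator norm of Σ_u (T_u − X_u) equals √2·|U|. -/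
theorem stmt11 {E : Type*} [NormedAddCommGroup E] [InnerProductSpace ℂ E]
    [FiniteDimensional ℂ E] [Nontrivial E]
    {ι : Type*} [Fintype ι] [Nonempty ι]
    (T X : ι → E →L[ℂ] E)
    (hsaT : ∀ u, IsSelfAdjoint (T u)) (hsaX : ∀ u, IsSelfAdjoint (X u))
    (hT2 : ∀ u, T u ^ 2 = 1) (hX2 : ∀ u, X u ^ 2 = 1)
    (hanti : ∀ u, T u * X u = -(X u * T u))
    (hTT : ∀ u v, u ≠ v → Commute (T u) (T v))
    (hTX : ∀ u v, u ≠ v → Commute (T u) (X v))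
    (hXX : ∀ u v, u ≠ v → Commute (X u) (X v)) :
    ‖∑ u, (T u - X u)‖ = Real.sqrt 2 * (Fintype.card ι : ℝ) := by
  set c : ℂ := ((Real.sqrt 2 : ℝ) : ℂ) with hc
  have hc2 : c ^ 2 = 2 := by
    rw [hc, ← Complex.ofReal_pow, Real.sq_sqrt zero_le_two, Complex.ofReal_ofNat]
  have hnc : ‖c‖ = Real.sqrt 2 := by simp [hc]
  have hc0 : c ≠ 0 := fun h => by simp [h] at hc2
  have hTT' : ∀ u x, T u (T u x) = x := fun u x => by
    simpa [sq] using DFunLike.congr_fun (hT2 u) x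
  have hXX' : ∀ u x, X u (X u x) = x := fun u x => by
    simpa [sq] using DFunLike.congr_fun (hX2 u) x
  have hanti' : ∀ u x, T u (X u x) = -X u (T u x) := fun u x => by
    simpa using DFunLike.congr_fun (hanti u) x
  have cTT : ∀ u v, u ≠ v → ∀ x, T u (T v x) = T v (T u x) := fun u v h x =>
    DFunLike.congr_fun (hTT u v h) x
  have cTX : ∀ u v, u ≠ v → ∀ x, T u (X v x) = X v (T u x) := fun u v h x =>
    DFunLike.congr_fun (hTX u v h) x
  have cXX : ∀ u v, u ≠ v → ∀ x, X u (X v x) = X v (X u x) := fun u v h x =>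
    DFunLike.congr_fun (hXX u v h) x
  apply le_antisymm
  · have hle : ∀ u, ‖T u - X u‖ ≤ Real.sqrt 2 := fun u => by
      refine Real.le_sqrt_of_sq_le ?_
      rw [← ((hsaT u).sub (hsaX u)).norm_mul_self]
      refine ContinuousLinearMap.opNorm_le_bound _ zero_le_two fun x => ?_
      have : ((T u - X u) * (T u - X u)) x = (2 : ℂ) • x := by
        simp [hTT', hXX', hanti', two_smul]; abel
      rw [this, norm_smul, Complex.norm_ofNat]
    calc ‖∑ u, (T u - X u)‖ ≤ ∑ _u : ι, Real.sqrt 2 := norm_sum_le_of_le _ fun u _ => hle u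
      _ = Real.sqrt 2 * Fintype.card ι := by simp [mul_comm]
  · obtain ⟨x, hx, h⟩ := exists_common_eigenvector_of_anticommuting
      (A := fun u => (T u - X u : E →L[ℂ] E).toLinearMap)
      (B := fun u => (T u + X u : E →L[ℂ] E).toLinearMap) hc0
      (fun u x => by simp [hc2, hTT', hXX', hanti', two_smul]; abel)
      (fun u x => by simp [hc2, hTT', hXX', hanti', two_smul])
      (fun u x => by simp [hTT', hXX', hanti']; abel)
      (fun u v huv x => by
        simp [cTT u v huv, cTX u v huv, cXX u v huv, cTX v u huv.symm]; abel)
      (fun u v huv x => by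
        simp [cTT u v huv, cTX u v huv, cXX u v huv, cTX v u huv.symm]; abel)
      Finset.univ
    replace h : ∀ u ∈ Finset.univ, (T u - X u) x = c • x := h
    have hsum : (∑ u, (T u - X u)) x = (Fintype.card ι * c) • x := by
      rw [sum_apply, Finset.sum_congr rfl h, Finset.sum_const,
        Finset.card_univ, ← Nat.cast_smul_eq_nsmul ℂ, smul_smul]
    have hle := (∑ u, (T u - X u)).le_opNorm x
    rw [hsum, norm_smul, norm_mul, hnc, Complex.norm_natCast, mul_comm (_ : ℝ) (Real.sqrt 2)] at hle
    exact le_of_mul_le_mul_right hle (norm_pos_iff.2 hx)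
end

section
/- Define Γ(θ,s) = √(2s²cos(2θ) + 4 − 8s + 6s²) and Δ₁(θ,s) = √(2(1−s+s²) + Γ(θ,s)) − √(2(1−s+s²) − Γ(θ,s)). Then for all θ ∈ ℝ and s ∈ [0,1]: Δ₁(θ,s) ≥ 0, and Δ₁(θ,s) = 0 if and only if s = 1 and cos θ = 0. In particular, if cos θ ≠ 0 then Δ₁(θ,s) > 0 for every s ∈ [0,1]. -/
noncomputable section

/-- Γ(θ,s) = √(2s²cos(2θ) + 4 − 8s + 6s²). -/
def Gam (θ s : ℝ) : ℝ :=
  Real.sqrt (2 * s ^ 2 * Real.cos (2 * θ) + 4 - 8 * s + 6 * s ^ 2)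

/-- Δ₁(θ,s) = √(2(1−s+s²) + Γ(θ,s)) − √(2(1−s+s²) − Γ(θ,s)). -/
def Delta1 (θ s : ℝ) : ℝ :=
  Real.sqrt (2 * (1 - s + s ^ 2) + Gam θ s) - Real.sqrt (2 * (1 - s + s ^ 2) - Gam θ s)

theorem Gam_radicand_eq (θ s : ℝ) :
    2 * s ^ 2 * Real.cos (2 * θ) + 4 - 8 * s + 6 * s ^ 2 =
      4 * ((s * Real.cos θ) ^ 2 + (1 - s) ^ 2) := by
  rw [Real.cos_two_mul]
  ring

theorem Gam_nonneg (θ s : ℝ) : 0 ≤ Gam θ s :=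
  Real.sqrt_nonneg _

theorem Gam_eq_zero_iff (θ s : ℝ) : Gam θ s = 0 ↔ s = 1 ∧ Real.cos θ = 0 := by
  rw [Gam, Gam_radicand_eq, Real.sqrt_eq_zero (by positivity)]
  constructor
  · intro h
    have hs : s = 1 := by nlinarith [sq_nonneg (s * Real.cos θ), sq_nonneg (1 - s)]
    subst hs
    exact ⟨rfl, by simpa using h⟩
  · rintro ⟨rfl, hc⟩
    simp [hc]

theorem Delta1_nonneg (θ s : ℝ) : 0 ≤ Delta1 θ s :=
  sub_nonneg.2 (Real.sqrt_le_sqrt (by linarith [Gam_nonneg θ s]))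

theorem Delta1_eq_zero_iff (θ s : ℝ) : Delta1 θ s = 0 ↔ s = 1 ∧ Real.cos θ = 0 := by
  rw [← Gam_eq_zero_iff]
  constructor
  · intro h
    by_contra hne
    have hpos : 0 < Gam θ s := lt_of_le_of_ne (Gam_nonneg θ s) (Ne.symm hne)
    have hlt := (Real.sqrt_lt_sqrt_iff_of_pos
      (x := 2 * (1 - s + s ^ 2) - Gam θ s) (y := 2 * (1 - s + s ^ 2) + Gam θ s)
      (by nlinarith [sq_nonneg (s - 1 / 2)])).2 (by linarith)
    exact (sub_pos.2 hlt).ne' h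
  · intro h
    simp [Delta1, h]

/-- for all θ ∈ ℝ and s ∈ [0,1]: Δ₁(θ,s) ≥ 0, and
Δ₁(θ,s) = 0 iff s = 1 and cos θ = 0; in particular, if cos θ ≠ 0 then
Δ₁(θ,s) > 0 on all of [0,1]. -/
theorem stmt15 :
    (∀ (θ : ℝ), ∀ s ∈ Set.Icc (0 : ℝ) 1,
        0 ≤ Delta1 θ s ∧ (Delta1 θ s = 0 ↔ s = 1 ∧ Real.cos θ = 0)) ∧
    (∀ (θ : ℝ), Real.cos θ ≠ 0 → ∀ s ∈ Set.Icc (0 : ℝ) 1, 0 < Delta1 θ s) := by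
  refine ⟨fun θ s _ => ⟨Delta1_nonneg θ s, Delta1_eq_zero_iff θ s⟩, fun θ hc s _ => ?_⟩
  exact lt_of_le_of_ne (Delta1_nonneg θ s)
    fun h => hc ((Delta1_eq_zero_iff θ s).1 h.symm).2

end
end

section
/- On the four-qubit Hilbert space (ℂ²)^{⊗4} with qubits labelled 1,2,3,4, consider H = −Z₁X₂Z₃ − Z₂X₃Z₄ − X₃. Then the smallest eigenvalue of H is −(1 + √2), and the corresponding eigenspace has dimension 4. -/
noncomputable section

open Finset Matrix

/-- The Pauli X matrix. -/
def Xmat : Matrix (Fin 2) (Fin 2) ℂ := !![0, 1; 1, 0]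

/-- The Pauli Z matrix. -/
def Zmat : Matrix (Fin 2) (Fin 2) ℂ := !![1, 0; 0, -1]

variable {V : Type*} [Fintype V] [DecidableEq V]

/-- Pauli X acting on tensor factor `v` of ⨂_{v∈V} ℂ², identity elsewhere. -/
def Xop (v : V) : Matrix (V → Fin 2) (V → Fin 2) ℂ :=
  Matrix.of fun a b => (if ∀ u, u ≠ v → a u = b u then 1 else 0) * Xmat (a v) (b v)

/-- Pauli Z acting on tensor factor `v` of ⨂_{v∈V} ℂ², identity elsewhere
(a diagonal matrix, since Z is diagonal). -/
def Zop (v : V) : Matrix (V → Fin 2) (V → Fin 2) ℂ :=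
  Matrix.diagonal fun f => Zmat (f v) (f v)

lemma Zop_commute (a b : V) : Commute (Zop a) (Zop b) := by
  simp only [Zop, Commute, SemiconjBy, Matrix.diagonal_mul_diagonal]
  exact congrArg Matrix.diagonal (funext fun f => mul_comm _ _)

/-- The product ∏_{w ∈ S} Z_w of Pauli Z operators over a finite set of sites. -/
def Zprod (S : Finset V) : Matrix (V → Fin 2) (V → Fin 2) ℂ :=
  S.noncommProd Zop fun a _ b _ _ => Zop_commute a b

/-- The graph-state stabilizer generator K_v = X_v ∏_{w ~ v} Z_w. -/
def K (G : SimpleGraph V) [DecidableRel G.Adj] (v : V) :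
    Matrix (V → Fin 2) (V → Fin 2) ℂ :=
  Xop v * Zprod (G.neighborFinset v)


/-- H = −Z₁X₂Z₃ − Z₂X₃Z₄ − X₃ on four qubits (labelled 1,2,3,4,
i.e. indices 0,1,2,3). -/
def Ham17 : Matrix (Fin 4 → Fin 2) (Fin 4 → Fin 2) ℂ :=
  -(Zop 0 * Xop 1 * Zop 2) - Zop 1 * Xop 2 * Zop 3 - Xop 2

/-- The bit string `a` with its bit at `v` flipped. -/
def flipBit (v : V) (a : V → Fin 2) : V → Fin 2 := Function.update a v (1 - a v)

omit [Fintype V] in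
lemma flipBit_flipBit (v : V) (a : V → Fin 2) : flipBit v (flipBit v a) = a := by
  simp [flipBit]

omit [Fintype V] in
lemma flipBit_comm (v w : V) (a : V → Fin 2) :
    flipBit v (flipBit w a) = flipBit w (flipBit v a) := by
  rcases eq_or_ne v w with rfl | h
  · rfl
  · have h' := h.symm
    simp only [flipBit, Function.update_of_ne h, Function.update_of_ne h']
    exact (Function.update_comm h _ _ _).symm

lemma Xop_apply (v : V) (a b : V → Fin 2) :
    Xop v a b = if flipBit v a = b then 1 else 0 := by
  have hX : ∀ i j : Fin 2, Xmat i j = if 1 - i = j then 1 else 0 := by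
    intro i j
    fin_cases i <;> fin_cases j <;> simp [Xmat]
  have hiff : flipBit v a = b ↔ 1 - a v = b v ∧ ∀ u, u ≠ v → a u = b u :=
    Function.update_eq_iff
  simp only [Xop, Matrix.of_apply, hX, hiff]
  split_ifs <;> simp_all

lemma Xop_mul_apply (v : V) (M : Matrix (V → Fin 2) (V → Fin 2) ℂ) (a b : V → Fin 2) :
    (Xop v * M) a b = M (flipBit v a) b := by
  simp [Matrix.mul_apply, Xop_apply]

lemma Xop_eq_one_apply (v : V) (a b : V → Fin 2) :
    Xop v a b = (1 : Matrix (V → Fin 2) (V → Fin 2) ℂ) (flipBit v a) b := by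
  rw [Xop_apply, Matrix.one_apply]

omit [DecidableEq V] in
lemma Zop_eq_one_apply (v : V) (a b : V → Fin 2) :
    Zop v a b = Zmat (a v) (a v) * (1 : Matrix (V → Fin 2) (V → Fin 2) ℂ) a b := by
  rw [Zop, Matrix.diagonal_apply, Matrix.one_apply, mul_ite, mul_one, mul_zero]

lemma Zop_mul_apply (v : V) (M : Matrix (V → Fin 2) (V → Fin 2) ℂ) (a b : V → Fin 2) :
    (Zop v * M) a b = Zmat (a v) (a v) * M a b := by
  rw [Zop, Matrix.diagonal_mul]

lemma Zmat_mul_self_apply (i : Fin 2) : Zmat i i * Zmat i i = 1 := by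
  fin_cases i <;> simp [Zmat]

lemma Zmat_mul_self_apply_mul (i : Fin 2) (c : ℂ) : Zmat i i * (Zmat i i * c) = c := by
  rw [← mul_assoc, Zmat_mul_self_apply, one_mul]

lemma Zmat_flip (i : Fin 2) : Zmat (1 - i) (1 - i) = -Zmat i i := by
  fin_cases i <;> simp [Zmat]

omit [Fintype V] in
lemma flipBit_self (v : V) (a : V → Fin 2) : flipBit v a v = 1 - a v :=
  Function.update_self ..

omit [Fintype V] in
lemma flipBit_of_ne {v w : V} (h : w ≠ v) (a : V → Fin 2) : flipBit v a w = a w :=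
  Function.update_of_ne h ..

lemma Xop_mul_self (v : V) : Xop v * Xop v = 1 := by
  ext a b
  rw [Xop_mul_apply, Xop_eq_one_apply, flipBit_flipBit]

lemma Zop_mul_self (v : V) : Zop v * Zop v = 1 := by
  ext a b
  rw [Zop_mul_apply, Zop_eq_one_apply, Zmat_mul_self_apply_mul]

/-- A matrix that anticommutes with an involution is traceless. -/
lemma trace_eq_zero_of_anticommute {n : Type*} [Fintype n] [DecidableEq n]
    {U W : Matrix n n ℂ} (hU : U * U = 1) (h : U * W = -(W * U)) : W.trace = 0 := by
  have h1 : (U * (U * W)).trace = -(U * (W * U)).trace := by rw [h, mul_neg, Matrix.trace_neg]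
  rw [Matrix.trace_mul_comm U (W * U), mul_assoc, hU, ← mul_assoc, hU, one_mul, mul_one] at h1
  linear_combination h1 / 2

section Involutions

variable {n : Type*} [Fintype n] [DecidableEq n] {A B C : Matrix n n ℂ}

lemma toLin'_toLin' (hB : B * B = 1) (x : n → ℂ) :
    Matrix.toLin' B (Matrix.toLin' B x) = x := by
  rw [← Matrix.toLin'_mul_apply, hB, Matrix.toLin'_one, LinearMap.id_apply]

lemma toLin'_add_toLin'_add (hA : A * A = 1) (hC : C * C = 1) (hAC : A * C = -(C * A))
    (x : n → ℂ) : Matrix.toLin' (A + C) (Matrix.toLin' (A + C) x) = (2 : ℂ) • x := by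
  have h : (A + C) * (A + C) = (2 : ℂ) • 1 := by
    rw [add_mul, mul_add, mul_add, hA, hC, hAC, two_smul]
    abel
  rw [← Matrix.toLin'_mul_apply, h, map_smul, Matrix.toLin'_one, LinearMap.smul_apply,
    LinearMap.id_apply]

lemma toLin'_add_toLin' (hAB : A * B = B * A) (hCB : C * B = B * C) (x : n → ℂ) :
    Matrix.toLin' (A + C) (Matrix.toLin' B x) = Matrix.toLin' B (Matrix.toLin' (A + C) x) := by
  rw [← Matrix.toLin'_mul_apply, ← Matrix.toLin'_mul_apply, add_mul, mul_add, hAB, hCB]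

end Involutions

section CommutingInvolutions

variable {E : Type*} [AddCommGroup E] [Module ℂ E] {D B : E →ₗ[ℂ] E} {s : ℂ}

/-- The spectral projection of `-D - B` for the value `-(1 + s)`, where `D ^ 2 = s ^ 2 = 2`,
`B ^ 2 = 1` and `D`, `B` commute. -/
lemma isProj_eigenspace (hs : s * s = 2) (hD : ∀ x, D (D x) = (2 : ℂ) • x)
    (hB : ∀ x, B (B x) = x) (hDB : ∀ x, D (B x) = B (D x)) :
    LinearMap.IsProj (Module.End.eigenspace (-D - B) (-(1 + s)))
      ((1 / 4 : ℂ) • LinearMap.id + (1 / 4 : ℂ) • B + (s / 8) • D + (s / 8) • (B * D)) where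
  map_mem x := by
    rw [Module.End.mem_eigenspace_iff]
    simp only [LinearMap.add_apply, LinearMap.sub_apply, LinearMap.neg_apply, LinearMap.smul_apply,
      LinearMap.id_apply, Module.End.mul_apply, map_add, map_smul, hD, hB, hDB]
    linear_combination (norm := module) (1 / 8 : ℂ) • (hs • (D x + B (D x)))
  map_id x hx := by
    rw [Module.End.mem_eigenspace_iff] at hx
    simp only [LinearMap.sub_apply, LinearMap.neg_apply] at hx
    have hBx := congrArg B hx
    have hDx := congrArg D hx
    simp only [map_sub, map_neg, map_smul, hB, hD, hDB] at hBx hDx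
    simp only [LinearMap.add_apply, LinearMap.smul_apply,
      LinearMap.id_apply, Module.End.mul_apply]
    linear_combination (norm := module) (-1 / 4 - s / 8) • hx + ((s - 2) / 8) • hBx +
      ((1 - s) / 4) • hDx + hs • ((1 / 8 : ℂ) • x - (1 / 8 : ℂ) • B x + (1 / 4 : ℂ) • D x)

/-- The eigenvalues of `-D - B` satisfy `(μ ^ 2 - 3) ^ 2 = 8`. -/
lemma eigenvalue_equation (hD : ∀ x, D (D x) = (2 : ℂ) • x)
    (hB : ∀ x, B (B x) = x) (hDB : ∀ x, D (B x) = B (D x)) {μ : ℂ}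
    (hμ : Module.End.HasEigenvalue (-D - B) μ) : (μ ^ 2 - 3) ^ 2 = 8 := by
  obtain ⟨v, hv⟩ := hμ.exists_hasEigenvector
  have h1 := hv.apply_eq_smul
  simp only [LinearMap.sub_apply, LinearMap.neg_apply] at h1
  have hBv := congrArg B h1
  have hDv := congrArg D h1
  simp only [map_sub, map_neg, map_smul, hB, hD, hDB] at hBv hDv
  have h2 : (2 : ℂ) • B (D v) = (μ ^ 2 - 3) • v := by
    linear_combination (norm := module) -hBv - hDv + μ • h1
  have h3 := congrArg (fun x => B (D x)) h2
  simp only [map_smul, hB, hD, hDB] at h3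
  have h4 : ((μ ^ 2 - 3) ^ 2 - 8) • v = 0 := by
    linear_combination (norm := module) (-2 : ℂ) • h3 - (μ ^ 2 - 3) • h2
  linear_combination (smul_eq_zero.mp h4).resolve_right hv.2

end CommutingInvolutions

lemma neg_one_sub_sqrt_two_le_re {μ : ℂ} (h : (μ ^ 2 - 3) ^ 2 = 8) :
    -(1 + Real.sqrt 2) ≤ μ.re := by
  have hs : ((Real.sqrt 2 : ℝ) : ℂ) ^ 2 = 2 := by
    rw [← Complex.ofReal_pow, Real.sq_sqrt zero_le_two, Complex.ofReal_ofNat]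
  have hs1 : 1 ≤ Real.sqrt 2 := Real.one_le_sqrt.mpr one_le_two
  have hfac : (μ - ((1 + Real.sqrt 2 : ℝ) : ℂ)) * (μ - ((-(1 + Real.sqrt 2) : ℝ) : ℂ)) *
      ((μ - ((1 - Real.sqrt 2 : ℝ) : ℂ)) * (μ - ((-(1 - Real.sqrt 2) : ℝ) : ℂ))) = 0 := by
    push_cast
    linear_combination h + (-2 * μ ^ 2 + ((Real.sqrt 2 : ℝ) : ℂ) ^ 2) * hs
  simp only [mul_eq_zero, sub_eq_zero] at hfac
  rcases hfac with (rfl | rfl) | rfl | rfl <;> rw [Complex.ofReal_re] <;> linarith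

/-- For involutions `A`, `B`, `C` with `A`, `C` anticommuting and commuting with `B`, and `B`
anticommuting with some involution, the lowest level of `-A - B - C` fills a quarter of the
space. -/
lemma finrank_eigenspace_of_involutions {n : Type*} [Fintype n] [DecidableEq n]
    {A B C U : Matrix n n ℂ} (hA : A * A = 1) (hC : C * C = 1) (hU : U * U = 1)
    (hB : B * B = 1) (hAB : A * B = B * A) (hCB : C * B = B * C) (hAC : A * C = -(C * A))
    (hUB : U * B = -(B * U)) {s : ℂ} (hs : s * s = 2) :
    (Module.finrank ℂ (Module.End.eigenspace (-Matrix.toLin' (A + C) - Matrix.toLin' B)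
      (-(1 + s))) : ℂ) = Fintype.card n / 4 := by
  have hCA : C * A = -(A * C) := by rw [hAC, neg_neg]
  have hCBA : C * (B * A) = -((B * A) * C) := by
    rw [← mul_assoc, hCB, mul_assoc, hCA, mul_neg, mul_assoc]
  have hABC : A * (B * C) = -((B * C) * A) := by
    rw [← mul_assoc, hAB, mul_assoc, hAC, mul_neg, mul_assoc]
  rw [← (isProj_eigenspace hs (toLin'_add_toLin'_add hA hC hAC) (toLin'_toLin' hB)
    (toLin'_add_toLin' hAB hCB)).trace]
  rw [map_add, map_add, map_add, map_smul, map_smul, map_smul, map_smul, Module.End.mul_eq_comp,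
    ← Matrix.toLin'_mul, LinearMap.trace_id, mul_add]
  simp only [Matrix.trace_toLin'_eq, Matrix.trace_add, trace_eq_zero_of_anticommute hU hUB,
    trace_eq_zero_of_anticommute hC hCA, trace_eq_zero_of_anticommute hA hAC,
    trace_eq_zero_of_anticommute hC hCBA, trace_eq_zero_of_anticommute hA hABC]
  simp
  ring

/-- The stabilizer `Z₁X₂Z₃` of the four-qubit chain. -/
def stabilizerOne : Matrix (Fin 4 → Fin 2) (Fin 4 → Fin 2) ℂ := Zop 0 * Xop 1 * Zop 2

/-- The stabilizer `Z₂X₃Z₄` of the four-qubit chain. -/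
def stabilizerTwo : Matrix (Fin 4 → Fin 2) (Fin 4 → Fin 2) ℂ := Zop 1 * Xop 2 * Zop 3

lemma stabilizerOne_mul_self : stabilizerOne * stabilizerOne = 1 := by
  ext a b
  simp [stabilizerOne, mul_assoc, Zop_mul_apply, Xop_mul_apply, Zop_eq_one_apply,
    flipBit_of_ne, flipBit_flipBit]
  linear_combination
    Zmat (a 2) (a 2) ^ 2 * (1 : Matrix (Fin 4 → Fin 2) (Fin 4 → Fin 2) ℂ) a b *
      Zmat_mul_self_apply (a 0) +
    (1 : Matrix (Fin 4 → Fin 2) (Fin 4 → Fin 2) ℂ) a b * Zmat_mul_self_apply (a 2)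

lemma stabilizerTwo_mul_self : stabilizerTwo * stabilizerTwo = 1 := by
  ext a b
  simp [stabilizerTwo, mul_assoc, Zop_mul_apply, Xop_mul_apply, Zop_eq_one_apply,
    flipBit_of_ne, flipBit_flipBit]
  linear_combination
    Zmat (a 3) (a 3) ^ 2 * (1 : Matrix (Fin 4 → Fin 2) (Fin 4 → Fin 2) ℂ) a b *
      Zmat_mul_self_apply (a 1) +
    (1 : Matrix (Fin 4 → Fin 2) (Fin 4 → Fin 2) ℂ) a b * Zmat_mul_self_apply (a 3)

lemma stabilizerOne_mul_stabilizerTwo :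
    stabilizerOne * stabilizerTwo = stabilizerTwo * stabilizerOne := by
  ext a b
  simp [stabilizerOne, stabilizerTwo, mul_assoc, Zop_mul_apply, Xop_mul_apply, Zop_eq_one_apply,
    flipBit_self, flipBit_of_ne, Zmat_flip, flipBit_comm (1 : Fin 4) 2]
  ring

lemma Xop_two_mul_stabilizerTwo : Xop 2 * stabilizerTwo = stabilizerTwo * Xop 2 := by
  ext a b
  simp [stabilizerTwo, mul_assoc, Zop_mul_apply, Xop_mul_apply, Zop_eq_one_apply,
    Xop_eq_one_apply, flipBit_of_ne]

lemma stabilizerOne_mul_Xop_two : stabilizerOne * Xop 2 = -(Xop 2 * stabilizerOne) := by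
  ext a b
  simp [stabilizerOne, mul_assoc, Zop_mul_apply, Xop_mul_apply, Zop_eq_one_apply,
    Xop_eq_one_apply, flipBit_self, flipBit_of_ne, Zmat_flip, flipBit_comm (1 : Fin 4) 2]

lemma Zop_two_mul_stabilizerTwo : Zop 2 * stabilizerTwo = -(stabilizerTwo * Zop 2) := by
  ext a b
  simp [stabilizerTwo, mul_assoc, Zop_mul_apply, Xop_mul_apply, Zop_eq_one_apply,
    flipBit_self, flipBit_of_ne, Zmat_flip]
  ring

/-- the smallest eigenvalue of H = −Z₁X₂Z₃ − Z₂X₃Z₄ − X₃ is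
−(1 + √2), and the corresponding eigenspace has dimension 4. -/
theorem stmt17 :
    Module.End.HasEigenvalue (Matrix.toLin' Ham17)
      ((-(1 + Real.sqrt 2) : ℝ) : ℂ) ∧
    (∀ μ : ℂ, Module.End.HasEigenvalue (Matrix.toLin' Ham17) μ →
      -(1 + Real.sqrt 2) ≤ μ.re) ∧
    Module.finrank ℂ
      (Module.End.eigenspace (Matrix.toLin' Ham17)
        ((-(1 + Real.sqrt 2) : ℝ) : ℂ)) = 4 := by
  have hs : ((Real.sqrt 2 : ℝ) : ℂ) * ((Real.sqrt 2 : ℝ) : ℂ) = 2 := by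
    rw [← Complex.ofReal_mul, Real.mul_self_sqrt zero_le_two, Complex.ofReal_ofNat]
  have hH : Matrix.toLin' Ham17 =
      -Matrix.toLin' (stabilizerOne + Xop 2) - Matrix.toLin' stabilizerTwo := by
    rw [← map_neg, ← map_sub]
    congr 1
    simp only [Ham17, stabilizerOne, stabilizerTwo]
    abel
  have hfin : Module.finrank ℂ (Module.End.eigenspace (Matrix.toLin' Ham17)
      ((-(1 + Real.sqrt 2) : ℝ) : ℂ)) = 4 := by
    have h := finrank_eigenspace_of_involutions stabilizerOne_mul_self (Xop_mul_self 2)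
      (Zop_mul_self 2) stabilizerTwo_mul_self stabilizerOne_mul_stabilizerTwo
      Xop_two_mul_stabilizerTwo stabilizerOne_mul_Xop_two Zop_two_mul_stabilizerTwo hs
    rw [← hH] at h
    have hE : ((-(1 + Real.sqrt 2) : ℝ) : ℂ) = -(1 + ((Real.sqrt 2 : ℝ) : ℂ)) := by push_cast; rfl
    rw [hE]
    norm_num at h
    exact_mod_cast h
  refine ⟨?_, fun μ hμ => ?_, hfin⟩
  · rw [Module.End.hasEigenvalue_iff]
    intro h
    rw [h, finrank_bot] at hfin
    norm_num at hfin
  · rw [hH] at hμ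
    exact neg_one_sub_sqrt_two_le_re (eigenvalue_equation
      (toLin'_add_toLin'_add stabilizerOne_mul_self (Xop_mul_self 2) stabilizerOne_mul_Xop_two)
      (toLin'_toLin' stabilizerTwo_mul_self)
      (toLin'_add_toLin' stabilizerOne_mul_stabilizerTwo Xop_two_mul_stabilizerTwo) hμ)

end
end
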